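/- Let M : ℝ^N → ℝ be an equilibrium distribution as defined in the context, let Φ : ℝ^N × ℝ^N → ℝ be measurable with |Φ(v,v′)| ≤ Φ̄ for all v, v′, let 1 < α < 2, and let ε > 0 be sufficiently small (in particular ε^{α-1} Φ̄ < 1). Then there exists a unique measurable F : ℝ^N → ℝ with F/M ∈ L^∞, ∫_{ℝ^N} F(v) dv = 1, and ∫_{ℝ^N} [ (1 + ε^{α-1} Φ(v,v′)) M(v) F(v′) − (1 + ε^{α-1} Φ(v′,v)) M(v′) F(v) ] dv′ = 0 for almost every v; moreover F satisfies (1 − ε^{α-1}Φ̄)/(1 + ε^{α-1}Φ̄) ≤ F(v)/M(v) ≤ (1 + ε^{α-1}Φ̄)/(1 − ε^{α-1}Φ̄) for almost every v. -/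

import Mathlib

open MeasureTheory Real

section Kernel

variable {X : Type*} [MeasurableSpace X] {μ : Measure X}

open scoped ENNReal in
/-- The Neumann series solves `h = f + K h` for a nonnegative kernel `K` whose columns all have
mass `q`. -/
lemma exists_eq_add_lintegral_kernel [SFinite μ] {K : X → X → ℝ≥0∞}
    (hK : Measurable (Function.uncurry K)) {q : ℝ≥0∞} (hq : ∀ y, ∫⁻ x, K x y ∂μ = q)
    {f : X → ℝ≥0∞} (hf : Measurable f) :
    ∃ h : X → ℝ≥0∞, Measurable h ∧ (∀ x, h x = f x + ∫⁻ y, K x y * h y ∂μ) ∧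
      ∫⁻ x, h x ∂μ = (∫⁻ x, f x ∂μ) * (1 - q)⁻¹ := by
  let T : (X → ℝ≥0∞) → X → ℝ≥0∞ := fun u x ↦ ∫⁻ y, K x y * u y ∂μ
  have hT : ∀ u, Measurable u → Measurable (T u) := fun u hu ↦
    Measurable.lintegral_prod_right' (f := fun p : X × X ↦ K p.1 p.2 * u p.2)
      (hK.mul (hu.comp measurable_snd))
  have hs : ∀ n, Measurable (T^[n] f) := by
    intro n
    induction n with
    | zero => exact hf
    | succ n ih => rw [Function.iterate_succ_apply']; exact hT _ ih
  have hKx : ∀ x, Measurable (K x) := fun x ↦ hK.comp measurable_prodMk_left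
  have hKy : ∀ y, Measurable fun x ↦ K x y := fun y ↦ hK.comp measurable_prodMk_right
  have hmass : ∀ n, ∫⁻ x, T^[n] f x ∂μ = (∫⁻ x, f x ∂μ) * q ^ n := by
    intro n
    induction n with
    | zero => simp
    | succ n ih =>
      rw [Function.iterate_succ_apply']
      change ∫⁻ x, ∫⁻ y, K x y * T^[n] f y ∂μ ∂μ = _
      rw [lintegral_lintegral_swap (hK.mul ((hs n).comp measurable_snd)).aemeasurable]
      simp_rw [lintegral_mul_const _ (hKy _), hq]
      rw [lintegral_const_mul _ (hs n), ih, pow_succ]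
      ring
  refine ⟨fun x ↦ ∑' n, T^[n] f x, Measurable.tsum hs, fun x ↦ ?_, ?_⟩
  · simp_rw [← ENNReal.tsum_mul_left]
    rw [lintegral_tsum (f := fun n y ↦ K x y * T^[n] f y)
        fun n ↦ ((hKx x).mul (hs n)).aemeasurable,
      tsum_eq_zero_add' ENNReal.summable]
    simp only [Function.iterate_succ_apply', Function.iterate_zero_apply, T]
  · rw [lintegral_tsum fun n ↦ (hs n).aemeasurable]
    simp_rw [hmass]
    rw [ENNReal.tsum_mul_left, ENNReal.tsum_geometric]

variable {k : X → X → ℝ} {a b : ℝ}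

lemma integrable_kernel_mul (hk : Measurable (Function.uncurry k)) (hl : ∀ x y, a ≤ k x y)
    (hu : ∀ x y, k x y ≤ b) {g : X → ℝ} (hg : Integrable g μ) (x : X) :
    Integrable (fun y ↦ k x y * g y) μ := by
  refine hg.bdd_mul (c := max |a| |b|) (hk.comp measurable_prodMk_left).aestronglyMeasurable
    (Filter.Eventually.of_forall fun y ↦ ?_)
  exact abs_le_max_abs_abs (hl x y) (hu x y)

variable [IsProbabilityMeasure μ]

lemma integrable_of_mem_Icc {f : X → ℝ} (hf : Measurable f) (hl : ∀ x, a ≤ f x)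
    (hu : ∀ x, f x ≤ b) : Integrable f μ :=
  Integrable.of_mem_Icc a b hf.aemeasurable (Filter.Eventually.of_forall fun x ↦ ⟨hl x, hu x⟩)

lemma integral_mem_Icc {f : X → ℝ} (hf : Measurable f) (hl : ∀ x, a ≤ f x)
    (hu : ∀ x, f x ≤ b) : a ≤ ∫ x, f x ∂μ ∧ ∫ x, f x ∂μ ≤ b := by
  have hi := integrable_of_mem_Icc (μ := μ) hf hl hu
  constructor
  · simpa using integral_mono (integrable_const a) hi hl
  · simpa using integral_mono hi (integrable_const b) hu

lemma measurable_column_integral (hk : Measurable (Function.uncurry k)) :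
    Measurable fun y ↦ ∫ x, k x y ∂μ :=
  (hk.comp measurable_swap).stronglyMeasurable.integral_prod_right'.measurable

lemma integral_gain_sub_loss (hk : Measurable (Function.uncurry k)) (hl : ∀ x y, a ≤ k x y)
    (hu : ∀ x y, k x y ≤ b) {g : X → ℝ} (hg : Integrable g μ) (x : X) :
    ∫ y, (k x y * g y - k y x * g x) ∂μ = ∫ y, k x y * g y ∂μ - (∫ y, k y x ∂μ) * g x := by
  rw [integral_sub (integrable_kernel_mul hk hl hu hg x), integral_mul_const]
  exact (integrable_of_mem_Icc (hk.comp measurable_prodMk_right) (fun y ↦ hl y x)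
    (fun y ↦ hu y x)).mul_const _

/-- Existence of an integrable nonnegative normalized equilibrium for a kernel bounded above and
below by positive constants. -/
lemma exists_nonneg_equilibrium (hk : Measurable (Function.uncurry k)) (ha : 0 < a)
    (hl : ∀ x y, a ≤ k x y) (hu : ∀ x y, k x y ≤ b) :
    ∃ g : X → ℝ, Measurable g ∧ Integrable g μ ∧ (∀ x, 0 ≤ g x) ∧ ∫ x, g x ∂μ = 1 ∧
      ∀ x, ∫ y, k x y * g y ∂μ = (∫ y, k y x ∂μ) * g x := by
  obtain ⟨x₀⟩ : Nonempty X := μ.nonempty_of_neZero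
  have hab : a ≤ b := (hl x₀ x₀).trans (hu x₀ x₀)
  have hb : 0 < b := ha.trans_le hab
  set r : X → ℝ := fun y ↦ ∫ x, k x y ∂μ with hr
  have hrm : Measurable r := measurable_column_integral hk
  have hky : ∀ y, Measurable fun x ↦ k x y := fun y ↦ hk.comp measurable_prodMk_right
  have hrI : ∀ y, a ≤ r y ∧ r y ≤ b := fun y ↦
    integral_mem_Icc (hky y) (fun x ↦ hl x y) (fun x ↦ hu x y)
  have hrpos : ∀ y, 0 < r y := fun y ↦ ha.trans_le (hrI y).1
  set β := a / b with hβ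
  have hβ0 : 0 < β := div_pos ha hb
  have hβ1 : β ≤ 1 := (div_le_one hb).2 hab
  let p : X → X → ℝ := fun x y ↦ k x y / r y - β
  have hpm : Measurable (Function.uncurry p) :=
    (hk.div (hrm.comp measurable_snd)).sub_const β
  have hp0 : ∀ x y, 0 ≤ p x y := fun x y ↦
    sub_nonneg.2 (div_le_div₀ (ha.le.trans (hl x y)) (hl x y) (hrpos y) (hrI y).2)
  have hpb : ∀ x y, p x y ≤ b / a := fun x y ↦ by
    have : k x y / r y ≤ b / a := div_le_div₀ hb.le (hu x y) ha (hrI y).1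
    simp only [p]; linarith
  have hcol : ∀ y, ∫⁻ x, ENNReal.ofReal (p x y) ∂μ = ENNReal.ofReal (1 - β) := by
    intro y
    have hpi : Integrable (fun x ↦ p x y) μ :=
      integrable_of_mem_Icc (hpm.comp measurable_prodMk_right) (fun x ↦ hp0 x y) (fun x ↦ hpb x y)
    rw [← ofReal_integral_eq_lintegral_ofReal hpi (Filter.Eventually.of_forall fun x ↦ hp0 x y)]
    congr 1
    have hki : Integrable (fun x ↦ k x y / r y) μ :=
      (integrable_of_mem_Icc (hky y) (fun x ↦ hl x y) (fun x ↦ hu x y)).div_const _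
    change ∫ x, (k x y / r y - β) ∂μ = _
    rw [integral_sub hki (integrable_const _), integral_div]
    simp [div_self (hrpos y).ne', show ∫ x, k x y ∂μ = r y from rfl]
  obtain ⟨h, hm, heq, hmass⟩ := exists_eq_add_lintegral_kernel (μ := μ)
    (K := fun x y ↦ ENNReal.ofReal (p x y)) hpm.ennreal_ofReal hcol
    (f := fun _ ↦ ENNReal.ofReal β) measurable_const
  have hmass1 : ∫⁻ x, h x ∂μ = 1 := by
    rw [hmass, lintegral_const, measure_univ, mul_one, ← ENNReal.ofReal_one,
      ← ENNReal.ofReal_sub _ (by linarith), sub_sub_cancel, ENNReal.ofReal_one]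
    exact ENNReal.mul_inv_cancel (by simpa using hβ0) ENNReal.ofReal_ne_top
  have hfin : ∀ x, h x ≠ ⊤ := by
    intro x
    rw [heq x]
    refine ENNReal.add_ne_top.2 ⟨ENNReal.ofReal_ne_top, ne_top_of_le_ne_top
      (ENNReal.ofReal_ne_top (r := b / a)) ?_⟩
    calc ∫⁻ y, ENNReal.ofReal (p x y) * h y ∂μ
        ≤ ∫⁻ y, ENNReal.ofReal (b / a) * h y ∂μ :=
          lintegral_mono fun y ↦ by gcongr; exact hpb x y
      _ = ENNReal.ofReal (b / a) := by rw [lintegral_const_mul _ hm, hmass1, mul_one]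
  set H : X → ℝ := fun x ↦ (h x).toReal with hH
  have hHm : Measurable H := hm.ennreal_toReal
  have hH0 : ∀ x, 0 ≤ H x := fun x ↦ ENNReal.toReal_nonneg
  have hHi : Integrable H μ :=
    integrable_toReal_of_lintegral_ne_top hm.aemeasurable (by simp [hmass1])
  have hH1 : ∫ x, H x ∂μ = 1 := by
    rw [integral_toReal hm.aemeasurable (Filter.Eventually.of_forall fun x ↦ (hfin x).lt_top),
      hmass1, ENNReal.toReal_one]
  have hgi : Integrable (fun x ↦ H x / r x) μ := by
    refine (hHi.div_const a).mono' (hHm.div hrm).aestronglyMeasurable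
      (Filter.Eventually.of_forall fun x ↦ ?_)
    rw [Real.norm_of_nonneg (div_nonneg (hH0 x) (hrpos x).le)]
    exact div_le_div_of_nonneg_left (hH0 x) ha (hrI x).1
  have hfix : ∀ x, ∫ y, k x y * (H y / r y) ∂μ = H x := by
    intro x
    have hHx : H x = β + ∫ y, p x y * H y ∂μ := by
      have hI : ∫ y, p x y * H y ∂μ = (∫⁻ y, ENNReal.ofReal (p x y) * h y ∂μ).toReal := by
        rw [integral_eq_lintegral_of_nonneg_ae
          (Filter.Eventually.of_forall fun y ↦ mul_nonneg (hp0 x y) (hH0 y))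
          ((hpm.comp measurable_prodMk_left).mul hHm).aestronglyMeasurable]
        congr 1
        refine lintegral_congr fun y ↦ ?_
        rw [ENNReal.ofReal_mul (hp0 x y), hH, ENNReal.ofReal_toReal (hfin y)]
      have hx := hfin x
      rw [heq x, ENNReal.add_ne_top] at hx
      rw [hI, hH]
      change (h x).toReal = _
      rw [heq x, ENNReal.toReal_add hx.1 hx.2, ENNReal.toReal_ofReal hβ0.le]
    have hsplit : ∀ y, p x y * H y = k x y * (H y / r y) - β * H y := fun y ↦ by
      simp only [p]; ring
    simp_rw [hsplit] at hHx
    rw [integral_sub (integrable_kernel_mul hk hl hu hgi x) (hHi.const_mul β),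
      integral_const_mul, hH1] at hHx
    linarith
  set c := ∫ x, H x / r x ∂μ with hc
  have hcpos : 0 < c := by
    have : ∫ x, H x / b ∂μ ≤ c := integral_mono (hHi.div_const b) hgi fun x ↦
      div_le_div_of_nonneg_left (hH0 x) (hrpos x) (hrI x).2
    rw [integral_div, hH1] at this
    exact (by positivity : (0 : ℝ) < 1 / b).trans_le this
  refine ⟨fun x ↦ H x / r x / c, (hHm.div hrm).div_const c, hgi.div_const c,
    fun x ↦ div_nonneg (div_nonneg (hH0 x) (hrpos x).le) hcpos.le, ?_, fun x ↦ ?_⟩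
  · rw [integral_div, ← hc, div_self hcpos.ne']
  · simp_rw [← mul_div_assoc]
    rw [integral_div]
    simp_rw [mul_div_assoc, hfix x]
    rw [← mul_div_assoc, ← mul_div_assoc, mul_div_cancel_left₀ _ (hrpos x).ne']

/-- Bounds on a nonnegative normalized equilibrium. -/
lemma equilibrium_bounds (hk : Measurable (Function.uncurry k)) (ha : 0 < a)
    (hl : ∀ x y, a ≤ k x y) (hu : ∀ x y, k x y ≤ b) {g : X → ℝ} (hg : Integrable g μ)
    (hg0 : ∀ x, 0 ≤ g x) (hg1 : ∫ x, g x ∂μ = 1)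
    {x : X} (heq : ∫ y, k x y * g y ∂μ = (∫ y, k y x ∂μ) * g x) :
    a / b ≤ g x ∧ g x ≤ b / a := by
  have hb : 0 < b := ha.trans_le ((hl x x).trans (hu x x))
  have hki := integrable_kernel_mul hk hl hu hg x
  have hlow : a ≤ ∫ y, k x y * g y ∂μ := by
    simpa [integral_const_mul, hg1] using integral_mono (hg.const_mul a) hki
      fun y ↦ mul_le_mul_of_nonneg_right (hl x y) (hg0 y)
  have hupp : ∫ y, k x y * g y ∂μ ≤ b := by
    simpa [integral_const_mul, hg1] using integral_mono hki (hg.const_mul b)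
      fun y ↦ mul_le_mul_of_nonneg_right (hu x y) (hg0 y)
  obtain ⟨h1, h2⟩ := integral_mem_Icc (μ := μ) (hk.comp measurable_prodMk_right)
    (fun y ↦ hl y x) (fun y ↦ hu y x)
  have h1' : a * g x ≤ (∫ y, k y x ∂μ) * g x := mul_le_mul_of_nonneg_right h1 (hg0 x)
  have h2' : (∫ y, k y x ∂μ) * g x ≤ b * g x := mul_le_mul_of_nonneg_right h2 (hg0 x)
  rw [div_le_iff₀ hb, le_div_iff₀ ha]
  constructor <;> linarith

/-- An equilibrium whose weighted mass vanishes is trivial. -/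
lemma equilibrium_ae_eq_zero (hk : Measurable (Function.uncurry k)) (ha : 0 < a)
    (hl : ∀ x y, a ≤ k x y) (hu : ∀ x y, k x y ≤ b) {w : X → ℝ} (hw : Integrable w μ)
    (hw0 : ∫ y, (∫ x, k x y ∂μ) * w y ∂μ = 0)
    (heq : ∀ᵐ x ∂μ, ∫ y, k x y * w y ∂μ = (∫ y, k y x ∂μ) * w x) : w =ᵐ[μ] 0 := by
  obtain ⟨x₀⟩ : Nonempty X := μ.nonempty_of_neZero
  have hab : a ≤ b := (hl x₀ x₀).trans (hu x₀ x₀)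
  have hb : 0 < b := ha.trans_le hab
  set r : X → ℝ := fun y ↦ ∫ x, k x y ∂μ with hr
  have hrm : Measurable r := measurable_column_integral hk
  have hky : ∀ y, Measurable fun x ↦ k x y := fun y ↦ hk.comp measurable_prodMk_right
  have hrI : ∀ y, a ≤ r y ∧ r y ≤ b := fun y ↦
    integral_mem_Icc (hky y) (fun x ↦ hl x y) (fun x ↦ hu x y)
  have hrpos : ∀ y, 0 < r y := fun y ↦ ha.trans_le (hrI y).1
  set β := a / b with hβ
  have hβ0 : 0 < β := div_pos ha hb
  have hrint : ∀ {u : X → ℝ}, Integrable u μ → Integrable (fun y ↦ r y * u y) μ := fun hu' ↦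
    integrable_kernel_mul (k := fun _ y ↦ r y) (hrm.comp measurable_snd)
      (fun _ y ↦ (hrI y).1) (fun _ y ↦ (hrI y).2) hu' x₀
  have hp0 : ∀ x y, 0 ≤ k x y - β * r y := fun x y ↦ by
    have : β * r y ≤ β * b := mul_le_mul_of_nonneg_left (hrI y).2 hβ0.le
    rw [hβ, div_mul_cancel₀ _ hb.ne'] at this
    linarith [hl x y]
  have hsplit : ∀ {u : X → ℝ}, Integrable u μ → ∀ x, ∫ y, (k x y - β * r y) * u y ∂μ
      = ∫ y, k x y * u y ∂μ - β * ∫ y, r y * u y ∂μ := fun {u} hu' x ↦ by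
    rw [← integral_const_mul,
      ← integral_sub (integrable_kernel_mul hk hl hu hu' x) ((hrint hu').const_mul β)]
    congr 1; ext y; ring
  have hpt : ∀ᵐ x ∂μ, r x * |w x| ≤ ∫ y, k x y * |w y| ∂μ - β * ∫ y, r y * |w y| ∂μ := by
    filter_upwards [heq] with x hx
    have h1 : r x * w x = ∫ y, (k x y - β * r y) * w y ∂μ := by
      rw [hsplit hw, hw0, hx]; ring
    rw [← hsplit hw.abs, ← abs_of_pos (hrpos x), ← abs_mul, h1]
    refine (abs_integral_le_integral_abs).trans_eq (integral_congr_ae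
      (Filter.Eventually.of_forall fun y ↦ ?_))
    simp only [abs_mul, abs_of_nonneg (hp0 x y)]
  have hprod : Integrable (fun z : X × X ↦ k z.1 z.2 * |w z.2|) (μ.prod μ) := by
    refine (hw.abs.comp_snd μ).bdd_mul (c := max |a| |b|) hk.aestronglyMeasurable
      (Filter.Eventually.of_forall fun z ↦ ?_)
    exact abs_le_max_abs_abs (hl z.1 z.2) (hu z.1 z.2)
  have hswap : ∫ x, ∫ y, k x y * |w y| ∂μ ∂μ = ∫ y, r y * |w y| ∂μ := by
    rw [integral_integral_swap hprod]
    simp_rw [integral_mul_const]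
    rfl
  have hmono := integral_mono_ae (hrint hw.abs)
    (hprod.integral_prod_left.sub (integrable_const (β * ∫ y, r y * |w y| ∂μ))) hpt
  simp only [Pi.sub_apply] at hmono
  rw [integral_sub hprod.integral_prod_left (integrable_const _)] at hmono
  simp only [hswap, integral_const, probReal_univ, one_smul] at hmono
  have hnn : ∀ y, 0 ≤ r y * |w y| := fun y ↦ mul_nonneg (hrpos y).le (abs_nonneg _)
  have hzero : ∫ y, r y * |w y| ∂μ = 0 :=
    le_antisymm (by nlinarith) (integral_nonneg hnn)
  filter_upwards [(integral_eq_zero_iff_of_nonneg hnn (hrint hw.abs)).1 hzero] with y hy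
  simpa [(hrpos y).ne'] using hy

/-- Two normalized equilibria agree almost everywhere. -/
lemma equilibrium_unique (hk : Measurable (Function.uncurry k)) (ha : 0 < a)
    (hl : ∀ x y, a ≤ k x y) (hu : ∀ x y, k x y ≤ b) {f g : X → ℝ}
    (hf : Integrable f μ) (hf1 : ∫ x, f x ∂μ = 1)
    (hfe : ∀ᵐ x ∂μ, ∫ y, k x y * f y ∂μ = (∫ y, k y x ∂μ) * f x)
    (hg : Integrable g μ) (hg0 : ∀ x, 0 ≤ g x) (hg1 : ∫ x, g x ∂μ = 1)
    (hge : ∀ᵐ x ∂μ, ∫ y, k x y * g y ∂μ = (∫ y, k y x ∂μ) * g x) : f =ᵐ[μ] g := by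
  obtain ⟨x₀⟩ : Nonempty X := μ.nonempty_of_neZero
  set r : X → ℝ := fun y ↦ ∫ x, k x y ∂μ with hr
  have hrm : Measurable r := measurable_column_integral hk
  have hrI : ∀ y, a ≤ r y ∧ r y ≤ b := fun y ↦
    integral_mem_Icc (hk.comp measurable_prodMk_right) (fun x ↦ hl x y) (fun x ↦ hu x y)
  have hrint : ∀ {u : X → ℝ}, Integrable u μ → Integrable (fun y ↦ r y * u y) μ := fun hu' ↦
    integrable_kernel_mul (k := fun _ y ↦ r y) (hrm.comp measurable_snd)
      (fun _ y ↦ (hrI y).1) (fun _ y ↦ (hrI y).2) hu' x₀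
  have hgpos : 0 < ∫ y, r y * g y ∂μ := by
    have := integral_mono (hg.const_mul a) (hrint hg)
      fun y ↦ mul_le_mul_of_nonneg_right (hrI y).1 (hg0 y)
    rw [integral_const_mul, hg1, mul_one] at this
    exact ha.trans_le this
  set c := (∫ y, r y * f y ∂μ) / ∫ y, r y * g y ∂μ with hc
  have hw : Integrable (fun y ↦ f y - c * g y) μ := hf.sub (hg.const_mul c)
  have hlin : ∀ (s : X → ℝ), Integrable (fun y ↦ s y * f y) μ → Integrable (fun y ↦ s y * g y) μ →
      ∫ y, s y * (f y - c * g y) ∂μ = ∫ y, s y * f y ∂μ - c * ∫ y, s y * g y ∂μ := by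
    intro s h1 h2
    rw [← integral_const_mul, ← integral_sub h1 (h2.const_mul c)]
    congr 1; ext y; ring
  have hz : (fun y ↦ f y - c * g y) =ᵐ[μ] 0 := by
    refine equilibrium_ae_eq_zero hk ha hl hu hw ?_ ?_
    · rw [hlin r (hrint hf) (hrint hg), hc, div_mul_cancel₀ _ hgpos.ne', sub_self]
    · filter_upwards [hfe, hge] with x h1 h2
      rw [hlin _ (integrable_kernel_mul hk hl hu hf x) (integrable_kernel_mul hk hl hu hg x),
        h1, h2]
      ring
  have hc1 : c = 1 := by
    have := integral_congr_ae hz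
    simp only [Pi.zero_apply, integral_zero] at this
    rw [integral_sub hf (hg.const_mul c), integral_const_mul, hf1, hg1] at this
    linarith
  filter_upwards [hz] with x hx
  simpa [hc1, sub_eq_zero] using hx

end Kernel

/-- Integration against a measure with positive real density. -/
lemma integral_withDensity_ofReal {X : Type*} [MeasurableSpace X] {ν : Measure X} {M : X → ℝ}
    (hM : Measurable M) (hpos : ∀ x, 0 < M x) (f : X → ℝ) :
    ∫ x, f x ∂ν.withDensity (fun x ↦ ENNReal.ofReal (M x)) = ∫ x, M x * f x ∂ν := by
  rw [integral_withDensity_eq_integral_toReal_smul hM.ennreal_ofReal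
    (Filter.Eventually.of_forall fun x ↦ ENNReal.ofReal_lt_top)]
  simp [ENNReal.toReal_ofReal (hpos _).le]

/-- Existence and uniqueness (up to a.e. equality) of the normalized equilibrium `F_ε`
of the full collision operator `Q_ε`, together with the pointwise bounds
`(1-ε^{α-1}Φ̄)/(1+ε^{α-1}Φ̄) ≤ F/M ≤ (1+ε^{α-1}Φ̄)/(1-ε^{α-1}Φ̄)`. -/
theorem stmt8 (N : ℕ) (hN : 0 < N) (α γ : ℝ) (hα1 : 1 < α) (hα2 : α < 2) (hγ : 0 < γ)
    (M : EuclideanSpace ℝ (Fin N) → ℝ) (hMmeas : Measurable M)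
    (hMpos : ∀ v, 0 < M v)
    (hMrad : ∀ v v' : EuclideanSpace ℝ (Fin N), ‖v‖ = ‖v'‖ → M v = M v')
    (hMint : Integrable M)
    (hMnorm : ∫ v, M v = 1)
    (hMtail : ∀ v : EuclideanSpace ℝ (Fin N), 1 ≤ ‖v‖ → M v = γ * ‖v‖ ^ (-(N : ℝ) - α))
    (Φ : EuclideanSpace ℝ (Fin N) → EuclideanSpace ℝ (Fin N) → ℝ)
    (hΦmeas : Measurable (Function.uncurry Φ))
    (Φbar : ℝ) (hΦbd : ∀ v v', |Φ v v'| ≤ Φbar)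
    (ε : ℝ) (hε : 0 < ε) (hsmall : ε ^ (α - 1) * Φbar < 1) :
    ∃ F : EuclideanSpace ℝ (Fin N) → ℝ,
      Measurable F ∧
      (∃ C : ℝ, ∀ᵐ v : EuclideanSpace ℝ (Fin N) ∂volume, |F v| ≤ C * M v) ∧
      (∫ v, F v = 1) ∧
      (∀ᵐ v : EuclideanSpace ℝ (Fin N) ∂volume,
        ∫ v', ((1 + ε ^ (α - 1) * Φ v v') * M v * F v'
            - (1 + ε ^ (α - 1) * Φ v' v) * M v' * F v) = 0) ∧
      (∀ᵐ v : EuclideanSpace ℝ (Fin N) ∂volume,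
        (1 - ε ^ (α - 1) * Φbar) / (1 + ε ^ (α - 1) * Φbar) ≤ F v / M v ∧
          F v / M v ≤ (1 + ε ^ (α - 1) * Φbar) / (1 - ε ^ (α - 1) * Φbar)) ∧
      (∀ G : EuclideanSpace ℝ (Fin N) → ℝ, Measurable G →
        (∃ C : ℝ, ∀ᵐ v : EuclideanSpace ℝ (Fin N) ∂volume, |G v| ≤ C * M v) →
        (∫ v, G v = 1) →
        (∀ᵐ v : EuclideanSpace ℝ (Fin N) ∂volume,
          ∫ v', ((1 + ε ^ (α - 1) * Φ v v') * M v * G v'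
              - (1 + ε ^ (α - 1) * Φ v' v) * M v' * G v) = 0) →
        G =ᵐ[volume] F) := by
  set δ := ε ^ (α - 1) * Φbar with hδ
  have hεpos : 0 < ε ^ (α - 1) := Real.rpow_pos_of_pos hε _
  let k : EuclideanSpace ℝ (Fin N) → EuclideanSpace ℝ (Fin N) → ℝ :=
    fun v v' ↦ 1 + ε ^ (α - 1) * Φ v v'
  have hk : Measurable (Function.uncurry k) := (hΦmeas.const_mul _).const_add 1
  have hδk : ∀ v v', |ε ^ (α - 1) * Φ v v'| ≤ δ := fun v v' ↦ by
    rw [abs_mul, abs_of_pos hεpos]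
    exact mul_le_mul_of_nonneg_left (hΦbd v v') hεpos.le
  have ha : 0 < 1 - δ := sub_pos.2 hsmall
  have hl : ∀ v v', 1 - δ ≤ k v v' := fun v v' ↦ by
    linarith [(abs_le.1 (hδk v v')).1, show k v v' = 1 + ε ^ (α - 1) * Φ v v' from rfl]
  have hu : ∀ v v', k v v' ≤ 1 + δ := fun v v' ↦ by
    linarith [(abs_le.1 (hδk v v')).2, show k v v' = 1 + ε ^ (α - 1) * Φ v v' from rfl]
  let μ : Measure (EuclideanSpace ℝ (Fin N)) :=
    volume.withDensity fun v ↦ ENNReal.ofReal (M v)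
  have : IsProbabilityMeasure μ := ⟨by
    rw [withDensity_apply _ MeasurableSet.univ, Measure.restrict_univ,
      ← ofReal_integral_eq_lintegral_ofReal hMint
        (Filter.Eventually.of_forall fun v ↦ (hMpos v).le), hMnorm, ENNReal.ofReal_one]⟩
  have hac : μ ≪ volume := withDensity_absolutelyContinuous _ _
  have hac' : volume ≪ μ := withDensity_absolutelyContinuous' hMmeas.ennreal_ofReal.aemeasurable
    (Filter.Eventually.of_forall fun v ↦ by simpa using hMpos v)
  have hcoll : ∀ {g : EuclideanSpace ℝ (Fin N) → ℝ}, Integrable g μ → ∀ v,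
      ∫ v', (k v v' * M v * (M v' * g v') - k v' v * M v' * (M v * g v))
        = M v * (∫ v', k v v' * g v' ∂μ - (∫ v', k v' v ∂μ) * g v) := fun {g} hg v ↦ by
    rw [← integral_gain_sub_loss hk hl hu hg, integral_withDensity_ofReal hMmeas hMpos,
      ← integral_const_mul]
    congr 1; ext v'; ring
  obtain ⟨g, hgm, hgi, hg0, hg1, hge⟩ := exists_nonneg_equilibrium (μ := μ) hk ha hl hu
  have hbd := fun v ↦ equilibrium_bounds hk ha hl hu hgi hg0 hg1 (hge v)
  refine ⟨fun v ↦ M v * g v, hMmeas.mul hgm,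
    ⟨(1 + δ) / (1 - δ), Filter.Eventually.of_forall fun v ↦ ?_⟩, ?_,
    Filter.Eventually.of_forall fun v ↦ ?_, Filter.Eventually.of_forall fun v ↦ ?_, ?_⟩
  · rw [abs_of_nonneg (mul_nonneg (hMpos v).le (hg0 v)), mul_comm]
    exact mul_le_mul_of_nonneg_right (hbd v).2 (hMpos v).le
  · rw [← integral_withDensity_ofReal hMmeas hMpos, hg1]
  · exact (hcoll hgi v).trans (by rw [hge v, sub_self, mul_zero])
  · simpa [mul_div_cancel_left₀ _ (hMpos v).ne'] using hbd v
  · rintro G hGm ⟨C, hC⟩ hG1 hGe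
    have hGM : ∀ v, M v * (G v / M v) = G v := fun v ↦ mul_div_cancel₀ _ (hMpos v).ne'
    have hfi : Integrable (fun v ↦ G v / M v) μ := by
      refine Integrable.of_bound (hGm.div hMmeas).aestronglyMeasurable C ?_
      filter_upwards [hac.ae_le hC] with v hv
      rwa [Real.norm_eq_abs, abs_div, abs_of_pos (hMpos v), div_le_iff₀ (hMpos v)]
    have hf1 : ∫ v, G v / M v ∂μ = 1 := by
      rw [integral_withDensity_ofReal hMmeas hMpos]
      simpa only [hGM] using hG1
    have hfe : ∀ᵐ v ∂μ, ∫ v', k v v' * (G v' / M v') ∂μ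
        = (∫ v', k v' v ∂μ) * (G v / M v) := by
      filter_upwards [hac.ae_le hGe] with v hv
      have h := hcoll hfi v
      simp only [hGM] at h
      exact sub_eq_zero.1 ((mul_eq_zero.1 (h.symm.trans hv)).resolve_left (hMpos v).ne')
    filter_upwards [hac'.ae_le (equilibrium_unique hk ha hl hu hfi hf1 hfe hgi hg0 hg1
      (Filter.Eventually.of_forall hge))] with v hv
    rw [← hv, hGM]
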